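/- Let f, g : 𝕋³ → ℝ be smooth functions each having zero mean on 𝕋² on every horizontal slice {z = const}, and set X := (∂_x f, ∂_y f, g) : 𝕋³ → ℝ³. Suppose every nonzero Fourier mode k = (k₁,k₂,k₃) ∈ ℤ³ of f and of g satisfies |(k₁,k₂)| ≥ λ for some λ > 0. Then there exists a smooth 3×3 matrix field D : 𝕋³ → ℝ^{3×3} whose third column is identically zero and whose top-left 2×2 block is symmetric and traceless at every point, such that the row-by-row horizontal divergence of D equals X (that is, Σ_{j=1,2} ∂_j D_{ij} = X_i for i = 1,2,3), and such that ‖D‖_{C⁰} ≤ C λ^{−1} ‖X‖_{C⁰}, with C a universal constant. -/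

import Mathlib

open Real MeasureTheory

noncomputable section

/-- Partial derivative of a scalar function in the `i`-th coordinate direction. -/
def pd3 (i : Fin 3) (f : (Fin 3 → ℝ) → ℝ) (x : Fin 3 → ℝ) : ℝ :=
  fderiv ℝ f x (Pi.single i 1)

/-- The fundamental domain `[0,2π]³` of the torus `𝕋³ = (ℝ/2πℤ)³`. -/
def box3 : Set (Fin 3 → ℝ) := Set.Icc 0 (fun _ => 2 * Real.pi)

/-- The fundamental domain `[0,2π]²` of the torus `𝕋² = (ℝ/2πℤ)²`. -/
def box2 : Set (Fin 2 → ℝ) := Set.Icc 0 (fun _ => 2 * Real.pi)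

/-- `2π`-periodicity in each of the three spatial variables. -/
def Periodic3 {E : Type*} (f : (Fin 3 → ℝ) → E) : Prop :=
  ∀ (x : Fin 3 → ℝ) (i : Fin 3), f (x + Pi.single i (2 * Real.pi)) = f x

/-- The `ℤ³` Fourier coefficient of `F : 𝕋³ → ℂ` at frequency `k = (k̄, k₃) ∈ ℤ² × ℤ`. -/
def fc3 (F : (Fin 3 → ℝ) → ℂ) (k : (ℤ × ℤ) × ℤ) : ℂ :=
  ((2 * Real.pi) ^ 3 : ℝ)⁻¹ • ∫ x in box3,
    F x * Complex.exp (-(Complex.I) *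
      Complex.ofReal ((k.1.1 : ℝ) * x 0 + (k.1.2 : ℝ) * x 1 + (k.2 : ℝ) * x 2))

/-- The Euclidean length of a horizontal frequency `k̄ ∈ ℤ²`. -/
def knorm (k : ℤ × ℤ) : ℝ := Real.sqrt ((k.1 : ℝ) ^ 2 + (k.2 : ℝ) ^ 2)

/-- The averaged translate `x ↦ ∫ w(ω) h(x - v(ω)) dμ(ω)` of a function `h`. -/
def shiftAvg {Ω E : Type*} [MeasurableSpace Ω] [NormedAddCommGroup E] [NormedSpace ℝ E]
    (μ : Measure Ω) (w : Ω → ℝ) (v : Ω → Fin 3 → ℝ) (h : (Fin 3 → ℝ) → E) (x : Fin 3 → ℝ) : E :=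
  ∫ ω, w ω • h (x - v ω) ∂μ

lemma Periodic3.add_int {E : Type*} {f : (Fin 3 → ℝ) → E} (hf : Periodic3 f) (x : Fin 3 → ℝ)
    (n : Fin 3 → ℤ) : f (x + fun i => 2 * π * n i) = f x := by
  have hp : ∀ i, Function.Periodic f (Pi.single i (2 * π)) := fun i x => hf x i
  have key : (x + fun i => 2 * π * n i) = x + n 0 • Pi.single 0 (2 * π)
      + n 1 • Pi.single 1 (2 * π) + n 2 • Pi.single 2 (2 * π) := by
    ext i
    fin_cases i <;> simp [mul_comm]
  rw [key, (hp 2).zsmul (n 2), (hp 1).zsmul (n 1), (hp 0).zsmul (n 0)]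

lemma Periodic3.exists_bound {E : Type*} [NormedAddCommGroup E] {f : (Fin 3 → ℝ) → E}
    (hf : Periodic3 f) (hc : Continuous f) : ∃ C, ∀ x, ‖f x‖ ≤ C := by
  have hK : IsCompact box3 := isCompact_Icc
  obtain ⟨C, hC⟩ := hK.exists_bound_of_continuousOn hc.continuousOn
  refine ⟨C, fun x => ?_⟩
  have hx : x = (fun i => toIcoMod two_pi_pos 0 (x i))
      + fun i => 2 * π * (toIcoDiv two_pi_pos 0 (x i) : ℤ) := by
    ext i
    have := toIcoMod_add_toIcoDiv_zsmul two_pi_pos 0 (x i)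
    rw [zsmul_eq_mul] at this
    simp only [Pi.add_apply]
    linarith
  rw [hx, hf.add_int]
  refine hC _ ⟨fun i => (toIcoMod_mem_Ico two_pi_pos 0 (x i)).1, fun i => ?_⟩
  simpa using (toIcoMod_mem_Ico two_pi_pos 0 (x i)).2.le

lemma Periodic3.fderiv {E : Type*} [NormedAddCommGroup E] [NormedSpace ℝ E]
    {f : (Fin 3 → ℝ) → E} (hf : Periodic3 f) : Periodic3 (fderiv ℝ f) := by
  intro x i
  rw [← fderiv_comp_add_right]
  congr 1
  ext y
  exact hf y i

lemma Periodic3.pd3 {f : (Fin 3 → ℝ) → ℝ} (hf : Periodic3 f) (i : Fin 3) :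
    Periodic3 (pd3 i f) := by
  intro x j
  simp only [_root_.pd3, hf.fderiv x j]

lemma contDiff_pd3 {f : (Fin 3 → ℝ) → ℝ} (hf : ContDiff ℝ (⊤ : ℕ∞) f) (i : Fin 3) :
    ContDiff ℝ (⊤ : ℕ∞) (pd3 i f) :=
  (hf.fderiv_right (m := (⊤ : ℕ∞)) le_rfl).clm_apply contDiff_const

lemma pd3_comm {f : (Fin 3 → ℝ) → ℝ} (hf : ContDiff ℝ (⊤ : ℕ∞) f) (i j : Fin 3)
    (x : Fin 3 → ℝ) : pd3 i (pd3 j f) x = pd3 j (pd3 i f) x := by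
  have hd : Differentiable ℝ (fderiv ℝ f) :=
    (hf.fderiv_right (m := (⊤ : ℕ∞)) le_rfl).differentiable (by simp)
  have h : ∀ i j : Fin 3, pd3 i (pd3 j f) x
      = fderiv ℝ (fderiv ℝ f) x (Pi.single i 1) (Pi.single j 1) := fun i j => by
    have : HasFDerivAt (pd3 j f) ((ContinuousLinearMap.apply ℝ ℝ (Pi.single j (1 : ℝ))).comp
        (fderiv ℝ (fderiv ℝ f) x)) x :=
      (ContinuousLinearMap.apply ℝ ℝ (Pi.single j (1 : ℝ) : Fin 3 → ℝ)).hasFDerivAt.comp x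
        (hd x).hasFDerivAt
    rw [pd3, this.fderiv]
    rfl
  rw [h, h]
  have := (hf.contDiffAt (x := x)).isSymmSndFDerivAt (by
    simpa using (by exact_mod_cast le_top : ((2 : ℕ∞) : WithTop ℕ∞) ≤ ((⊤ : ℕ∞) : WithTop ℕ∞)))
  exact this _ _

section ShiftAvg

variable {Ω : Type*} [MeasurableSpace Ω] {μ : Measure Ω} {w : Ω → ℝ} {v : Ω → Fin 3 → ℝ}

lemma integrable_shift {E : Type*} [NormedAddCommGroup E] [NormedSpace ℝ E]
    (hw : Integrable w μ) (hv : AEStronglyMeasurable v μ) {h : (Fin 3 → ℝ) → E}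
    (hc : Continuous h) (hp : Periodic3 h) (x : Fin 3 → ℝ) :
    Integrable (fun ω => w ω • h (x - v ω)) μ := by
  obtain ⟨C, hC⟩ := hp.exists_bound hc
  refine hw.smul_bdd C (hc.comp_aestronglyMeasurable
    (aestronglyMeasurable_const.sub hv)) (.of_forall fun ω => hC _)

lemma Periodic3.shiftAvg {E : Type*} [NormedAddCommGroup E] [NormedSpace ℝ E]
    {h : (Fin 3 → ℝ) → E} (hp : Periodic3 h) : Periodic3 (shiftAvg μ w v h) := by
  intro x i
  simp only [_root_.shiftAvg, add_sub_right_comm, hp _ i]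

lemma hasFDerivAt_shiftAvg {E : Type*} [NormedAddCommGroup E] [NormedSpace ℝ E]
    (hw : Integrable w μ) (hv : AEStronglyMeasurable v μ) {h : (Fin 3 → ℝ) → E}
    (hc : ContDiff ℝ 1 h) (hp : Periodic3 h) (x : Fin 3 → ℝ) :
    HasFDerivAt (shiftAvg μ w v h) (shiftAvg μ w v (fderiv ℝ h) x) x := by
  obtain ⟨C, hC⟩ := hp.fderiv.exists_bound (hc.continuous_fderiv (by simp))
  refine hasFDerivAt_integral_of_dominated_of_fderiv_le (bound := fun ω => ‖w ω‖ * C)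
    (F' := fun x ω => w ω • fderiv ℝ h (x - v ω)) Filter.univ_mem
    (.of_forall fun y => (integrable_shift hw hv hc.continuous hp y).aestronglyMeasurable)
    (integrable_shift hw hv hc.continuous hp x)
    (integrable_shift hw hv (hc.continuous_fderiv (by simp)) hp.fderiv x).aestronglyMeasurable
    (.of_forall fun ω y _ => ?_) (hw.norm.mul_const C) (.of_forall fun ω y _ => ?_)
  · rw [norm_smul]
    gcongr
    exact hC _
  · have := ((hc.differentiable (by simp)) (y - v ω)).hasFDerivAt
    exact ((hasFDerivAt_comp_sub (f := h) (v ω)).2 this).const_smul (w ω)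

lemma contDiff_shiftAvg_nat (hw : Integrable w μ) (hv : AEStronglyMeasurable v μ) (n : ℕ) :
    ∀ {E : Type} [NormedAddCommGroup E] [NormedSpace ℝ E] {h : (Fin 3 → ℝ) → E},
      ContDiff ℝ (⊤ : ℕ∞) h → Periodic3 h → ContDiff ℝ n (shiftAvg μ w v h) := by
  have hder : ∀ {E : Type} [NormedAddCommGroup E] [NormedSpace ℝ E] {h : (Fin 3 → ℝ) → E},
      ContDiff ℝ (⊤ : ℕ∞) h → Periodic3 h → ∀ x,
      HasFDerivAt (shiftAvg μ w v h) (shiftAvg μ w v (fderiv ℝ h) x) x := fun hc hp x =>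
    hasFDerivAt_shiftAvg hw hv (hc.of_le (by exact_mod_cast le_top)) hp x
  induction n with
  | zero =>
    intro E _ _ h hc hp
    exact contDiff_zero.2 (continuous_iff_continuousAt.2 fun x => (hder hc hp x).continuousAt)
  | succ n ih =>
    intro E _ _ h hc hp
    push_cast
    refine contDiff_succ_iff_fderiv.2 ⟨fun x => (hder hc hp x).differentiableAt, by simp, ?_⟩
    rw [show fderiv ℝ (shiftAvg μ w v h) = shiftAvg μ w v (fderiv ℝ h) from
      funext fun x => (hder hc hp x).fderiv]
    exact ih (hc.fderiv_right (m := (⊤ : ℕ∞)) le_rfl) hp.fderiv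

lemma contDiff_shiftAvg (hw : Integrable w μ) (hv : AEStronglyMeasurable v μ)
    {h : (Fin 3 → ℝ) → ℝ} (hc : ContDiff ℝ (⊤ : ℕ∞) h) (hp : Periodic3 h) :
    ContDiff ℝ (⊤ : ℕ∞) (shiftAvg μ w v h) :=
  contDiff_infty.2 fun n => contDiff_shiftAvg_nat hw hv n hc hp

lemma pd3_shiftAvg (hw : Integrable w μ) (hv : AEStronglyMeasurable v μ)
    {h : (Fin 3 → ℝ) → ℝ} (hc : ContDiff ℝ (⊤ : ℕ∞) h) (hp : Periodic3 h) (i : Fin 3) :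
    pd3 i (shiftAvg μ w v h) = shiftAvg μ w v (pd3 i h) := by
  ext x
  have hc1 : ContDiff ℝ 1 h := hc.of_le (by exact_mod_cast le_top)
  rw [pd3, (hasFDerivAt_shiftAvg hw hv hc1 hp x).fderiv, shiftAvg, shiftAvg,
    ContinuousLinearMap.integral_apply
      (integrable_shift hw hv (hc1.continuous_fderiv (by simp)) hp.fderiv x)]
  rfl

lemma abs_shiftAvg_le (hw : Integrable w μ) {h : (Fin 3 → ℝ) → ℝ} {M : ℝ}
    (hM : ∀ x, |h x| ≤ M) (x : Fin 3 → ℝ) :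
    |shiftAvg μ w v h x| ≤ (∫ ω, |w ω| ∂μ) * M := by
  rw [← integral_mul_const, ← Real.norm_eq_abs]
  refine norm_integral_le_of_norm_le (hw.abs.mul_const M) (.of_forall fun ω => ?_)
  rw [norm_smul]
  exact mul_le_mul_of_nonneg_left (hM _) (norm_nonneg _)

end ShiftAvg

/-- The function on the unit torus induced by a `2π`-periodic function. -/
def torusLift (H : (Fin 3 → ℝ) → ℂ) (t : UnitAddTorus (Fin 3)) : ℂ :=
  H fun i => 2 * π * Quotient.out (t i)

lemma torusLift_coe {H : (Fin 3 → ℝ) → ℂ} (hp : Periodic3 H) (x : Fin 3 → ℝ) :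
    torusLift H (fun i => (x i : UnitAddCircle)) = H ((2 * π) • x) := by
  have h : ∀ i, ∃ n : ℤ, x i + n = Quotient.out (x i : UnitAddCircle) := fun i => by
    have : ((Quotient.out (x i : UnitAddCircle) : ℝ) : UnitAddCircle) = x i := Quotient.out_eq _
    rw [← sub_eq_zero, ← AddCircle.coe_sub, AddCircle.coe_eq_zero_iff] at this
    obtain ⟨n, hn⟩ := this
    exact ⟨n, by rw [zsmul_eq_mul, mul_one] at hn; linarith⟩
  choose n hn using h
  rw [torusLift, ← hp.add_int ((2 * π) • x) n]
  congr 1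
  ext i
  simp [← hn, mul_add]

lemma continuous_torusLift {H : (Fin 3 → ℝ) → ℂ} (hp : Periodic3 H) (hc : Continuous H) :
    Continuous (torusLift H) := by
  have hq : IsOpenQuotientMap (Pi.map fun (_ : Fin 3) (x : ℝ) => (x : UnitAddCircle)) :=
    IsOpenQuotientMap.piMap fun _ => QuotientAddGroup.isOpenQuotientMap_mk
  rw [hq.isQuotientMap.continuous_iff]
  have : torusLift H ∘ (Pi.map fun (_ : Fin 3) (x : ℝ) => (x : UnitAddCircle))
      = fun x => H ((2 * π) • x) := funext fun x => torusLift_coe hp x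
  rw [this]
  fun_prop

open scoped Pointwise in
lemma setIntegral_box3 (H : (Fin 3 → ℝ) → ℂ) :
    ∫ x in box3, H x = ((2 * π) ^ 3 : ℝ) •
      ∫ x in {x : Fin 3 → ℝ | ∀ i, x i ∈ Set.Ioc ((0 : Fin 3 → ℝ) i) ((0 : Fin 3 → ℝ) i + 1)},
        H ((2 * π) • x) := by
  rw [Measure.setIntegral_comp_smul_of_pos volume H _ two_pi_pos, smul_smul]
  have h2 : (2 * π) ^ 3 * ((2 * π) ^ Module.finrank ℝ (Fin 3 → ℝ))⁻¹ = 1 := by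
    simp [Real.pi_ne_zero]
  rw [h2, one_smul]
  have : (2 * π) • {x : Fin 3 → ℝ | ∀ i, x i ∈ Set.Ioc ((0 : Fin 3 → ℝ) i) ((0 : Fin 3 → ℝ) i + 1)}
      = Set.pi Set.univ fun i => Set.Ioc ((0 : Fin 3 → ℝ) i) ((fun _ => 2 * π : Fin 3 → ℝ) i) := by
    ext x
    rw [Set.mem_smul_set_iff_inv_smul_mem₀ two_pi_pos.ne']
    simp only [Set.mem_ofPred_eq, Set.mem_pi, Set.mem_univ, true_imp_iff, Set.mem_Ioc,
      Pi.smul_apply, Pi.zero_apply, smul_eq_mul, zero_add]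
    refine forall_congr' fun i => ?_
    rw [inv_mul_le_one₀ two_pi_pos, mul_pos_iff_of_pos_left (inv_pos.2 two_pi_pos)]
  rw [this, box3]
  exact setIntegral_congr_set Measure.univ_pi_Ioc_ae_eq_Icc.symm

lemma Periodic3.setIntegral_box3_add {H : (Fin 3 → ℝ) → ℂ} (hp : Periodic3 H) (a : Fin 3 → ℝ) :
    ∫ x in box3, H (x + a) = ∫ x in box3, H x := by
  rw [setIntegral_box3, setIntegral_box3]
  congr 1
  set b : Fin 3 → ℝ := (2 * π)⁻¹ • a with hb
  have ha : a = (2 * π) • b := by rw [hb, smul_inv_smul₀ two_pi_pos.ne']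
  have h0 := UnitAddTorus.integral_preimage (torusLift H) 0
  have h1 := UnitAddTorus.integral_preimage (torusLift H) b
  simp only [torusLift_coe hp] at h0 h1
  rw [← h0, h1, ha]
  simp only [← smul_add]
  have := (measurePreserving_add_right (volume : Measure (Fin 3 → ℝ)) b).setIntegral_preimage_emb
    (MeasurableEquiv.addRight b).measurableEmbedding (fun x => H ((2 * π) • x))
    {x : Fin 3 → ℝ | ∀ i, x i ∈ Set.Ioc (b i) (b i + 1)}
  rw [← this]
  congr 2
  ext x
  simp [add_comm]

lemma eq_zero_of_fc3_eq_zero {H : (Fin 3 → ℝ) → ℂ} (hp : Periodic3 H) (hc : Continuous H)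
    (h : ∀ k, fc3 H k = 0) (x : Fin 3 → ℝ) : H x = 0 := by
  have hcoef : ∀ n, UnitAddTorus.mFourierCoeff (torusLift H) n = 0 := fun n => by
    have h1 := h ((n 0, n 1), n 2)
    rw [fc3, setIntegral_box3, smul_smul, inv_mul_cancel₀ (by positivity), one_smul] at h1
    rw [UnitAddTorus.mFourierCoeff_eq_integral _ n 0, ← h1]
    refine integral_congr_ae (.of_forall fun x => ?_)
    simp only [torusLift_coe hp, UnitAddTorus.mFourier, ContinuousMap.coe_mk, fourier_coe_apply,
      Fin.prod_univ_three, ← Complex.exp_add, smul_eq_mul]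
    rw [mul_comm]
    congr 2
    simp
    ring
  let G : C(UnitAddTorus (Fin 3), ℂ) := ⟨torusLift H, continuous_torusLift hp hc⟩
  have hG : UnitAddTorus.mFourierCoeff G = 0 := funext hcoef
  have := UnitAddTorus.hasSum_mFourier_series_apply_of_summable (f := G)
    (by rw [hG]; exact summable_zero) (fun i => (((2 * π)⁻¹ • x) i : ℝ))
  simp only [hG, Pi.zero_apply, zero_smul] at this
  have h2 := this.unique hasSum_zero
  change torusLift H _ = 0 at h2
  rwa [torusLift_coe hp, smul_inv_smul₀ two_pi_pos.ne'] at h2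

lemma fc3_zero_of_slice {f : (Fin 3 → ℝ) → ℝ} (hc : Continuous f)
    (h : ∀ z : ℝ, (∫ y in box2, f ![y 0, y 1, z]) = 0) : fc3 (fun x => (f x : ℂ)) 0 = 0 := by
  suffices ∫ x in box3, f x = 0 by
    simp [fc3, integral_complex_ofReal, this]
  have hm := (volume_preserving_piFinSuccAbove (fun _ : Fin 3 => ℝ) 2).symm
  rw [← hm.setIntegral_preimage_emb (MeasurableEquiv.measurableEmbedding _)]
  have hset : (MeasurableEquiv.piFinSuccAbove (fun _ : Fin 3 => ℝ) 2).symm ⁻¹' box3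
      = Set.Icc 0 (2 * π) ×ˢ box2 := by
    ext ⟨z, y⟩
    simp [box3, box2, Pi.le_def, Fin.forall_fin_succ, Fin.insertNth, Fin.succAboveCases]
    tauto
  have hfun : ∀ p : ℝ × (Fin 2 → ℝ), (MeasurableEquiv.piFinSuccAbove (fun _ : Fin 3 => ℝ) 2).symm p
      = ![p.2 0, p.2 1, p.1] := fun p => by
    ext i
    fin_cases i <;> rfl
  rw [hset]
  simp only [hfun]
  rw [Measure.volume_eq_prod, setIntegral_prod]
  · simp [h]
  · refine ContinuousOn.integrableOn_compact (isCompact_Icc.prod isCompact_Icc) ?_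
    fun_prop

lemma exists_radial_bandlimited_kernel : ∃ ψ : ℂ → ℝ, Continuous ψ ∧ Integrable ψ ∧
    Integrable (fun y => ‖y‖ * ψ y) ∧ ∫ y, ψ y = 1 ∧
    (∀ (c : Circle) (y : ℂ), ψ (c * y) = ψ y) ∧
    ∀ ξ : ℂ, 1 ≤ ‖ξ‖ → ∫ y, (ψ y : ℂ) *
      Complex.exp (-Complex.I * ((ξ.re * y.re + ξ.im * y.im : ℝ) : ℂ)) = 0 := by
  let b : ℂ → ℂ := fun ξ => (Real.smoothTransition (1 - (2 * π) ^ 2 * ‖ξ‖ ^ 2) : ℂ)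
  have hbs : ContDiff ℝ (⊤ : ℕ∞) b :=
    Complex.ofRealCLM.contDiff.comp (Real.smoothTransition.contDiff.comp
      (contDiff_const.sub (contDiff_const.mul (contDiff_norm_sq ℝ))))
  have hb0 : ∀ ξ : ℂ, 1 ≤ 2 * π * ‖ξ‖ → b ξ = 0 := fun ξ hξ => by
    simp only [b, Complex.ofReal_eq_zero]
    refine Real.smoothTransition.zero_of_nonpos ?_
    nlinarith
  have hbc : HasCompactSupport b := by
    refine HasCompactSupport.intro (isCompact_closedBall (0 : ℂ) 1) fun ξ hξ => hb0 ξ ?_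
    simp only [Metric.mem_closedBall, dist_zero_right, not_le] at hξ
    nlinarith [Real.pi_gt_three]
  let B : SchwartzMap ℂ ℂ := hbc.toSchwartzMap hbs
  let φ : SchwartzMap ℂ ℂ := FourierTransformInv.fourierInv B
  have hφ : (φ : ℂ → ℂ) = FourierTransformInv.fourierInv b := SchwartzMap.fourierInv_coe B
  have hFφ : FourierTransform.fourier (φ : ℂ → ℂ) = b := by
    have h1 : FourierTransform.fourier φ = B := FourierTransform.fourier_fourierInv_eq B
    rw [← SchwartzMap.fourier_coe, h1]
    rfl
  have hFint : ∀ ξ : ℂ, ∫ y, φ y * Complex.exp (-Complex.I * ((ξ.re * y.re + ξ.im * y.im : ℝ) : ℂ))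
      = b ((2 * π)⁻¹ • ξ) := fun ξ => by
    rw [← hFφ, Real.fourier_eq']
    refine integral_congr_ae (.of_forall fun y => ?_)
    simp only [smul_eq_mul]
    rw [mul_comm]
    congr 2
    simp [Complex.inner]
    field_simp
  have hint : Integrable (φ : ℂ → ℂ) := φ.integrable
  have hF1 : ∫ y, φ y = 1 := by
    have := hFint 0
    simpa [b] using this
  refine ⟨fun y => (φ y).re, Complex.continuous_re.comp φ.continuous, hint.re, ?_, ?_, ?_, ?_⟩
  · refine (φ.integrable_pow_mul volume 1).mono'
      (continuous_norm.mul (Complex.continuous_re.comp φ.continuous)).aestronglyMeasurable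
      (.of_forall fun y => ?_)
    simp only [norm_mul, norm_norm, pow_one]
    gcongr
    exact Complex.abs_re_le_norm _
  · have := integral_re hint
    rw [hF1] at this
    exact this
  · intro c y
    have h1 := Real.fourierInv_comp_linearIsometry (rotation c) b y
    have h2 : b ∘ rotation c = b := by
      ext ξ
      simp [b, -rotation_apply]
    rw [h2, ← hφ, rotation_apply] at h1
    exact congrArg Complex.re h1.symm
  · intro ξ hξ
    have hz : ∀ ζ : ℂ, ‖ζ‖ = ‖ξ‖ → b ((2 * π)⁻¹ • ζ) = 0 := fun ζ hζ => by
      refine hb0 _ ?_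
      rw [norm_smul, hζ, norm_of_nonneg (inv_nonneg.2 two_pi_pos.le),
        mul_inv_cancel_left₀ two_pi_pos.ne']
      exact hξ
    have hA := (hFint ξ).trans (hz ξ rfl)
    have hB := congrArg (starRingEnd ℂ) ((hFint (-ξ)).trans (hz (-ξ) (norm_neg ξ)))
    rw [← integral_conj, map_zero] at hB
    have hi : ∀ ζ : ℂ, Integrable fun y : ℂ =>
        φ y * Complex.exp (-Complex.I * ((ζ.re * y.re + ζ.im * y.im : ℝ) : ℂ)) := fun ζ => by
      refine hint.mul_bdd (c := 1) (by fun_prop) (.of_forall fun y => ?_)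
      rw [neg_mul, mul_comm, ← neg_mul, ← Complex.ofReal_neg, Complex.norm_exp_ofReal_mul_I]
    have hsum := integral_add (hi ξ)
      ((Complex.conjCLE : ℂ ≃L[ℝ] ℂ).toContinuousLinearMap.integrable_comp (hi (-ξ)))
    have hB' : ∫ y, (Complex.conjCLE : ℂ ≃L[ℝ] ℂ).toContinuousLinearMap (φ y *
        Complex.exp (-Complex.I * (((-ξ).re * y.re + (-ξ).im * y.im : ℝ) : ℂ))) = 0 := hB
    rw [hA, hB', add_zero] at hsum
    rw [← mul_zero (2⁻¹ : ℂ), ← hsum, ← integral_const_mul]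
    refine integral_congr_ae (.of_forall fun y => ?_)
    have he : (starRingEnd ℂ) (Complex.exp
        (-Complex.I * (((-ξ).re * y.re + (-ξ).im * y.im : ℝ) : ℂ)))
        = Complex.exp (-Complex.I * ((ξ.re * y.re + ξ.im * y.im : ℝ) : ℂ)) := by
      rw [← Complex.exp_conj]
      congr 1
      simp only [map_mul, map_neg, Complex.conj_I, Complex.conj_ofReal, Complex.neg_re,
        Complex.neg_im]
      push_cast
      ring
    change _ = 2⁻¹ * (_ + (starRingEnd ℂ) _)
    rw [map_mul, he, ← add_mul, Complex.add_conj]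
    push_cast
    ring

lemma continuous_shiftAvg {Ω E : Type*} [MeasurableSpace Ω] {μ : Measure Ω} {w : Ω → ℝ}
    {v : Ω → Fin 3 → ℝ} [NormedAddCommGroup E] [NormedSpace ℝ E]
    (hw : Integrable w μ) (hv : AEStronglyMeasurable v μ) {h : (Fin 3 → ℝ) → E}
    (hc : Continuous h) (hp : Periodic3 h) : Continuous (shiftAvg μ w v h) := by
  obtain ⟨C, hC⟩ := hp.exists_bound hc
  refine continuous_of_dominated
    (fun x => (integrable_shift hw hv hc hp x).aestronglyMeasurable)
    (bound := fun ω => ‖w ω‖ * C) (fun x => .of_forall fun ω => ?_) (hw.norm.mul_const C)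
    (.of_forall fun ω => by fun_prop)
  rw [norm_smul]
  exact mul_le_mul_of_nonneg_left (hC _) (norm_nonneg _)

lemma fc3_shiftAvg {Ω : Type*} [MeasurableSpace Ω] {μ : Measure Ω} [SFinite μ] {w : Ω → ℝ}
    {v : Ω → Fin 3 → ℝ} (hw : Integrable w μ) (hv : AEStronglyMeasurable v μ)
    {H : (Fin 3 → ℝ) → ℂ} (hc : Continuous H) (hp : Periodic3 H) (k : (ℤ × ℤ) × ℤ) :
    fc3 (shiftAvg μ w v H) k = (∫ ω, (w ω : ℂ) * Complex.exp (-Complex.I *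
      Complex.ofReal (k.1.1 * v ω 0 + k.1.2 * v ω 1 + k.2 * v ω 2)) ∂μ) * fc3 H k := by
  obtain ⟨C, hC⟩ := hp.exists_bound hc
  let e : (Fin 3 → ℝ) → ℂ := fun x => Complex.exp (-Complex.I *
    Complex.ofReal (k.1.1 * x 0 + k.1.2 * x 1 + k.2 * x 2))
  have hec : Continuous e := by fun_prop
  have hen : ∀ x, ‖e x‖ = 1 := fun x => by
    simp only [e]
    rw [neg_mul, mul_comm, ← neg_mul, ← Complex.ofReal_neg, Complex.norm_exp_ofReal_mul_I]
  have hadd : ∀ x y, e (x + y) = e x * e y := fun x y => by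
    simp only [e, ← Complex.exp_add]
    congr 1
    push_cast [Pi.add_apply]
    ring
  have hpe : Periodic3 fun x => H x * e x := fun x i => by
    have h1 : e (Pi.single i (2 * π)) = 1 := by
      refine Complex.exp_eq_one_iff.2 ?_
      fin_cases i
      · exact ⟨-k.1.1, by simp; ring⟩
      · exact ⟨-k.1.2, by simp; ring⟩
      · exact ⟨-k.2, by simp; ring⟩
    simp only [hp x i, hadd, h1, mul_one]
  have hfin : IsFiniteMeasure ((volume : Measure (Fin 3 → ℝ)).restrict box3) :=
    isFiniteMeasure_restrict.2 isCompact_Icc.measure_ne_top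
  have hprod : Integrable (Function.uncurry fun (x : Fin 3 → ℝ) ω => w ω • H (x - v ω) * e x)
      ((volume.restrict box3).prod μ) := by
    refine (Integrable.comp_snd (hw.norm.mul_const C) (volume.restrict box3)).mono' ?_
      (.of_forall fun p => ?_)
    · refine ((hw.aestronglyMeasurable.comp_snd).smul (hc.comp_aestronglyMeasurable
        (measurable_fst.aestronglyMeasurable.sub hv.comp_snd))).mul
        (hec.comp_aestronglyMeasurable measurable_fst.aestronglyMeasurable)
    · simp only [Function.uncurry, norm_mul, norm_smul, hen, mul_one]
      exact mul_le_mul_of_nonneg_left (hC _) (norm_nonneg _)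
  have hswap := integral_integral_swap hprod
  have hinner : ∀ ω, ∫ x in box3, w ω • H (x - v ω) * e x
      = ((w ω : ℂ) * e (v ω)) * ∫ x in box3, H x * e x := fun ω => by
    rw [← hpe.setIntegral_box3_add (-v ω), ← integral_const_mul]
    refine integral_congr_ae (.of_forall fun x => ?_)
    have : e x = e (v ω) * e (x + -v ω) := by rw [← hadd]; congr 1; abel
    simp only [this, Complex.real_smul, sub_eq_add_neg]
    ring
  have hL : ∫ x in box3, shiftAvg μ w v H x * e x
      = ∫ x in box3, ∫ ω, w ω • H (x - v ω) * e x ∂μ := by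
    simp only [shiftAvg, integral_mul_const]
  rw [fc3, fc3, mul_smul_comm]
  congr 1
  change ∫ x in box3, shiftAvg μ w v H x * e x
    = (∫ ω, (w ω : ℂ) * e (v ω) ∂μ) * ∫ x in box3, H x * e x
  rw [hL, hswap]
  simp only [hinner, integral_mul_const]

/-- The horizontal vector `(Re y, Im y, 0)`. -/
def hvec : ℂ →L[ℝ] (Fin 3 → ℝ) := ContinuousLinearMap.pi ![Complex.reCLM, Complex.imCLM, 0]

lemma hvec_apply (y : ℂ) : hvec y = ![y.re, y.im, 0] := by
  ext i
  fin_cases i <;> rfl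

lemma shiftAvg_eq_zero_of_spectrum {ψ : ℂ → ℝ} (hψ : Integrable ψ)
    (hband : ∀ ξ : ℂ, 1 ≤ ‖ξ‖ → ∫ y, (ψ y : ℂ) *
      Complex.exp (-Complex.I * ((ξ.re * y.re + ξ.im * y.im : ℝ) : ℂ)) = 0)
    {f : (Fin 3 → ℝ) → ℝ} (hc : Continuous f) (hp : Periodic3 f) {lam : ℝ} (hlam : 0 < lam)
    (hspec : ∀ k, fc3 (fun x => (f x : ℂ)) k ≠ 0 → lam ≤ knorm k.1) (x : Fin 3 → ℝ) :
    shiftAvg volume ψ (fun y => lam⁻¹ • hvec y) f x = 0 := by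
  have hv : AEStronglyMeasurable (fun y => lam⁻¹ • hvec y) volume :=
    (hvec.continuous.const_smul lam⁻¹).aestronglyMeasurable
  have hcC : Continuous fun x => (f x : ℂ) := Complex.continuous_ofReal.comp hc
  have hpC : Periodic3 fun x => (f x : ℂ) := fun x i => by simp only [hp x i]
  have h0 := eq_zero_of_fc3_eq_zero (H := shiftAvg volume ψ (fun y => lam⁻¹ • hvec y)
    fun x => (f x : ℂ)) hpC.shiftAvg (continuous_shiftAvg hψ hv hcC hpC) (fun k => ?_) x
  · rw [← Complex.ofReal_eq_zero, ← h0, shiftAvg, shiftAvg, ← integral_complex_ofReal]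
    simp
  · rw [fc3_shiftAvg hψ hv hcC hpC]
    by_cases hk : fc3 (fun x => (f x : ℂ)) k = 0
    · rw [hk, mul_zero]
    · have hb := hband (lam⁻¹ • (⟨k.1.1, k.1.2⟩ : ℂ)) (by
        rw [norm_smul, norm_of_nonneg (inv_nonneg.2 hlam.le), Complex.norm_def,
          Complex.normSq_mk, ← pow_two, ← pow_two]
        exact (one_le_inv_mul₀ hlam).2 (hspec k hk))
      rw [mul_eq_zero]
      left
      rw [← hb]
      refine integral_congr_ae (.of_forall fun y => ?_)
      simp [hvec_apply]
      left
      ring_nf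

lemma norm_hvec_le (y : ℂ) : ‖hvec y‖ ≤ ‖y‖ := by
  refine (pi_norm_le_iff_of_nonneg (norm_nonneg y)).2 fun i => ?_
  rw [hvec_apply]
  fin_cases i
  · exact Complex.abs_re_le_norm y
  · exact Complex.abs_im_le_norm y
  · simp

lemma fderiv_hvec (h : (Fin 3 → ℝ) → ℝ) (z : Fin 3 → ℝ) (y : ℂ) :
    fderiv ℝ h z (hvec y) = y.re * pd3 0 h z + y.im * pd3 1 h z := by
  have : hvec y = y.re • Pi.single 0 1 + y.im • Pi.single 1 1 := by
    rw [hvec_apply]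
    ext i
    fin_cases i <;> simp
  rw [this, map_add, map_smul, map_smul]
  rfl

/-- The measure `dy ds` on `ℂ × (0, 1]`. -/
def segMeasure : Measure (ℂ × ℝ) := (volume : Measure ℂ).prod (volume.restrict (Set.Ioc 0 1))

/-- The weight `lam⁻¹ L(y) ψ(y)` on `ℂ × ℝ`. -/
def segWeight (ψ : ℂ → ℝ) (lam : ℝ) (L : ℂ → ℝ) (p : ℂ × ℝ) : ℝ := lam⁻¹ * (L p.1 * ψ p.1)

/-- The point at parameter `s` of the segment from `0` to `lam⁻¹ (Re y, Im y, 0)`. -/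
def segShift (lam : ℝ) (p : ℂ × ℝ) : Fin 3 → ℝ := p.2 • lam⁻¹ • hvec p.1

instance : SFinite segMeasure := by unfold segMeasure; infer_instance

lemma aestronglyMeasurable_segShift (lam : ℝ) :
    AEStronglyMeasurable (segShift lam) segMeasure := by
  have : Continuous (segShift lam) := by unfold segShift; fun_prop
  exact this.aestronglyMeasurable

section Kernel

variable {ψ : ℂ → ℝ} (hψc : Continuous ψ) (hψ1 : Integrable fun y => ‖y‖ * ψ y)
include hψc hψ1

lemma integrable_mul_kernel {L : ℂ → ℝ} (hL : Continuous L) (hLn : ∀ y, |L y| ≤ ‖y‖) :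
    Integrable fun y => L y * ψ y := by
  refine hψ1.norm.mono' (hL.mul hψc).aestronglyMeasurable (.of_forall fun y => ?_)
  simp only [norm_mul, norm_norm]
  exact mul_le_mul_of_nonneg_right (hLn y) (norm_nonneg _)

lemma integrable_segWeight {L : ℂ → ℝ} (hL : Continuous L) (hLn : ∀ y, |L y| ≤ ‖y‖) (lam : ℝ) :
    Integrable (segWeight ψ lam L) segMeasure :=
  (Integrable.comp_fst (integrable_mul_kernel hψc hψ1 hL hLn) _).const_mul _

lemma integral_abs_segWeight_le {L : ℂ → ℝ} (hL : Continuous L) (hLn : ∀ y, |L y| ≤ ‖y‖)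
    {lam : ℝ} (hlam : 0 < lam) :
    ∫ p, |segWeight ψ lam L p| ∂segMeasure ≤ lam⁻¹ * ∫ y, |‖y‖ * ψ y| := by
  have hI := integrable_mul_kernel hψc hψ1 hL hLn
  rw [segMeasure, integral_prod _ (integrable_segWeight hψc hψ1 hL hLn lam).abs]
  simp only [segWeight, abs_mul, abs_inv, abs_of_pos hlam, integral_const,
    measureReal_restrict_apply, MeasurableSet.univ, Set.univ_inter, Real.volume_real_Ioc,
    smul_eq_mul]
  simp only [sub_zero, zero_le_one, sup_of_le_left, one_mul, integral_const_mul, abs_norm]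
  refine mul_le_mul_of_nonneg_left (integral_mono ?_ ?_ fun y => ?_) (inv_nonneg.2 hlam.le)
  · simpa only [abs_mul] using hI.abs
  · simpa only [abs_mul, abs_norm] using hψ1.abs
  · exact mul_le_mul_of_nonneg_right (hLn y) (abs_nonneg _)

lemma shiftAvg_segment_fderiv {f : (Fin 3 → ℝ) → ℝ} (hc : ContDiff ℝ (⊤ : ℕ∞) f)
    (hp : Periodic3 f) (hψ : Integrable ψ) (hψone : ∫ y, ψ y = 1) (lam : ℝ) (x : Fin 3 → ℝ) :
    shiftAvg segMeasure (segWeight ψ lam Complex.re) (segShift lam) (pd3 0 f) x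
      + shiftAvg segMeasure (segWeight ψ lam Complex.im) (segShift lam) (pd3 1 f) x
      = f x - shiftAvg volume ψ (fun y => lam⁻¹ • hvec y) f x := by
  have hi0 := integrable_shift (integrable_segWeight hψc hψ1 Complex.continuous_re
    Complex.abs_re_le_norm lam) (aestronglyMeasurable_segShift lam) (contDiff_pd3 hc 0).continuous
    (hp.pd3 0) x
  have hi1 := integrable_shift (integrable_segWeight hψc hψ1 Complex.continuous_im
    Complex.abs_im_le_norm lam) (aestronglyMeasurable_segShift lam) (contDiff_pd3 hc 1).continuous
    (hp.pd3 1) x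
  have hi := hi0.add hi1
  rw [shiftAvg, shiftAvg, ← integral_add hi0 hi1]
  have hpt : ∀ p : ℂ × ℝ, segWeight ψ lam Complex.re p • pd3 0 f (x - segShift lam p)
      + segWeight ψ lam Complex.im p • pd3 1 f (x - segShift lam p)
      = ψ p.1 * fderiv ℝ f (x - p.2 • lam⁻¹ • hvec p.1) (lam⁻¹ • hvec p.1) := fun p => by
    rw [map_smul, fderiv_hvec]
    simp only [segWeight, segShift, smul_eq_mul]
    ring
  have hi' := hi.congr (.of_forall hpt)
  rw [integral_congr_ae (.of_forall hpt)]
  rw [segMeasure] at hi' ⊢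
  rw [integral_prod _ hi']
  have hinner : ∀ y : ℂ, ∫ s in Set.Ioc (0 : ℝ) 1,
      ψ y * fderiv ℝ f (x - s • lam⁻¹ • hvec y) (lam⁻¹ • hvec y)
      = ψ y * f x - ψ y • f (x - lam⁻¹ • hvec y) := fun y => by
    set u := lam⁻¹ • hvec y
    have hd : ∀ s ∈ Set.uIcc (0 : ℝ) 1, HasDerivAt (fun s : ℝ => -f (x - s • u))
        (fderiv ℝ f (x - s • u) u) s := fun s _ => by
      have h1 : HasDerivAt (fun s : ℝ => x - s • u) (-u) s := by
        simpa using ((hasDerivAt_id s).smul_const u).const_sub x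
      have h2 := ((hc.differentiable (by simp)) (x - s • u)).hasFDerivAt.comp_hasDerivAt s h1
      have h3 := h2.neg
      rw [map_neg, neg_neg] at h3
      exact h3
    have hcont : Continuous fun s : ℝ => fderiv ℝ f (x - s • u) u := by
      have := hc.continuous_fderiv (by simp)
      fun_prop
    rw [integral_const_mul, ← intervalIntegral.integral_of_le zero_le_one,
      intervalIntegral.integral_eq_sub_of_hasDerivAt hd (hcont.intervalIntegrable _ _)]
    simp
    ring
  simp only [hinner]
  have hI : Integrable fun y => ψ y • f (x - lam⁻¹ • hvec y) :=
    integrable_shift hψ (Continuous.aestronglyMeasurable (by fun_prop)) hc.continuous hp x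
  rw [integral_sub (hψ.mul_const _) hI, integral_mul_const, hψone, one_mul, shiftAvg]

lemma integral_kernel_mul_rotational_fderiv {h : (Fin 3 → ℝ) → ℝ} (hc : ContDiff ℝ (⊤ : ℕ∞) h)
    (hp : Periodic3 h) (hψ : Integrable ψ) (hrot : ∀ (c : Circle) (y : ℂ), ψ (c * y) = ψ y)
    {c : ℝ} (hc0 : c ≠ 0) (x : Fin 3 → ℝ) :
    ∫ y, ψ y * fderiv ℝ h (x - c • hvec y) (hvec (Complex.I * y)) = 0 := by
  have hcf : Continuous (fderiv ℝ h) := hc.continuous_fderiv (by simp)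
  obtain ⟨C, hC⟩ := hp.fderiv.exists_bound hcf
  have hG := hasDerivAt_integral_of_dominated_loc_of_deriv_le (μ := (volume : Measure ℂ))
    (F := fun (θ : ℝ) y => ψ y * h (x - c • hvec (Complex.exp (θ * Complex.I) * y)))
    (F' := fun (θ : ℝ) y => ψ y * fderiv ℝ h (x - c • hvec (Complex.exp (θ * Complex.I) * y))
      (-(c • hvec (Complex.exp (θ * Complex.I) * Complex.I * y))))
    (bound := fun y => ‖‖y‖ * ψ y‖ * (C * |c|)) (x₀ := 0) (s := Set.univ) Filter.univ_mem
    (.of_forall fun θ => by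
      have := hc.continuous
      exact Continuous.aestronglyMeasurable (by fun_prop))
    (integrable_shift hψ (Continuous.aestronglyMeasurable (by fun_prop)) hc.continuous hp x)
    (Continuous.aestronglyMeasurable (by fun_prop))
    (.of_forall fun y θ _ => by
      have h1 := ((fderiv ℝ h (x - c • hvec (Complex.exp (θ * Complex.I) * y))).le_opNorm
        (-(c • hvec (Complex.exp (θ * Complex.I) * Complex.I * y))))
      have h2 := norm_hvec_le (Complex.exp (θ * Complex.I) * Complex.I * y)
      rw [norm_mul, norm_mul, Complex.norm_exp_ofReal_mul_I, Complex.norm_I, one_mul, one_mul] at h2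
      rw [norm_neg, norm_smul, Real.norm_eq_abs c] at h1
      have hC0 : 0 ≤ C := (norm_nonneg _).trans (hC 0)
      rw [norm_mul, norm_mul, norm_norm]
      calc _ ≤ ‖ψ y‖ * (C * (|c| * ‖y‖)) := by
            gcongr
            refine h1.trans ?_
            gcongr
            exact hC _
        _ = _ := by ring)
    (hψ1.norm.mul_const _)
    (.of_forall fun y θ _ => by
      have h1 : HasDerivAt (fun θ : ℝ => Complex.exp (θ * Complex.I) * y)
          (Complex.exp (θ * Complex.I) * Complex.I * y) θ := by
        have := ((Complex.ofRealCLM.hasDerivAt (x := θ)).mul_const Complex.I).cexp.mul_const y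
        simpa using this
      have h2 := ((hvec.hasFDerivAt.comp_hasDerivAt θ h1).const_smul c).const_sub x
      exact (((hc.differentiable (by simp)) _).hasFDerivAt.comp_hasDerivAt θ h2).const_mul (ψ y))
  have hconst : (fun θ : ℝ => ∫ y, ψ y * h (x - c • hvec (Complex.exp (θ * Complex.I) * y)))
      = fun _ => ∫ y, ψ y * h (x - c • hvec y) := by
    ext θ
    have := (rotation (Circle.exp θ)).measurePreserving.integral_comp
      (rotation (Circle.exp θ)).toHomeomorph.measurableEmbedding
      (fun y => ψ y * h (x - c • hvec y))
    simp only [rotation_apply, hrot] at this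
    simpa only [Circle.coe_exp] using this
  have h0 := hG.2
  rw [hconst] at h0
  have h1 := h0.unique (hasDerivAt_const _ _)
  simp only [Complex.ofReal_zero, zero_mul, Complex.exp_zero, one_mul, map_neg, map_smul,
    smul_eq_mul] at h1
  have h2 : ∀ y, ψ y * -(c * fderiv ℝ h (x - c • hvec y) (hvec (Complex.I * y)))
      = -c * (ψ y * fderiv ℝ h (x - c • hvec y) (hvec (Complex.I * y))) := fun y => by ring
  simp only [h2, integral_const_mul] at h1
  exact (mul_eq_zero.1 h1).resolve_left (neg_ne_zero.2 hc0)

lemma shiftAvg_segment_rotational {h : (Fin 3 → ℝ) → ℝ} (hc : ContDiff ℝ (⊤ : ℕ∞) h)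
    (hp : Periodic3 h) (hψ : Integrable ψ) (hrot : ∀ (c : Circle) (y : ℂ), ψ (c * y) = ψ y)
    {lam : ℝ} (hlam : 0 < lam) (x : Fin 3 → ℝ) :
    shiftAvg segMeasure (segWeight ψ lam Complex.re) (segShift lam) (pd3 1 h) x
      = shiftAvg segMeasure (segWeight ψ lam Complex.im) (segShift lam) (pd3 0 h) x := by
  have hi0 := integrable_shift (integrable_segWeight hψc hψ1 Complex.continuous_re
    Complex.abs_re_le_norm lam) (aestronglyMeasurable_segShift lam) (contDiff_pd3 hc 1).continuous
    (hp.pd3 1) x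
  have hi1 := integrable_shift (integrable_segWeight hψc hψ1 Complex.continuous_im
    Complex.abs_im_le_norm lam) (aestronglyMeasurable_segShift lam) (contDiff_pd3 hc 0).continuous
    (hp.pd3 0) x
  have hi := hi0.sub hi1
  rw [← sub_eq_zero, shiftAvg, shiftAvg, ← integral_sub hi0 hi1]
  have hpt : ∀ p : ℂ × ℝ, segWeight ψ lam Complex.re p • pd3 1 h (x - segShift lam p)
      - segWeight ψ lam Complex.im p • pd3 0 h (x - segShift lam p)
      = lam⁻¹ * (ψ p.1 * fderiv ℝ h (x - (p.2 * lam⁻¹) • hvec p.1) (hvec (Complex.I * p.1))) :=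
    fun p => by
      rw [fderiv_hvec]
      simp [segWeight, segShift, smul_smul]
      ring
  have hi' := hi.congr (.of_forall hpt)
  rw [integral_congr_ae (.of_forall hpt)]
  rw [segMeasure] at hi' ⊢
  rw [integral_prod_symm _ hi']
  refine setIntegral_eq_zero_of_forall_eq_zero fun s hs => ?_
  simp only [integral_const_mul]
  rw [integral_kernel_mul_rotational_fderiv hψc hψ1 hc hp hψ hrot
    (mul_ne_zero hs.1.ne' (inv_ne_zero hlam.ne')), mul_zero]

end Kernel

/-- At frequencies of horizontal size at least `lam` there are operators `T₀, T₁` of norm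
`O(lam⁻¹)` on `C⁰` which commute with derivatives and act as `∂ₓ Δ⁻¹, ∂_y Δ⁻¹`, where `Δ` is the
horizontal Laplacian. -/
lemma exists_inverse_gradient_operators : ∃ K : ℝ, 0 ≤ K ∧ ∀ lam : ℝ, 0 < lam →
    ∃ T : Fin 2 → ((Fin 3 → ℝ) → ℝ) → (Fin 3 → ℝ) → ℝ,
      (∀ i h, ContDiff ℝ (⊤ : ℕ∞) h → Periodic3 h → ContDiff ℝ (⊤ : ℕ∞) (T i h)) ∧
      (∀ i h, Periodic3 h → Periodic3 (T i h)) ∧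
      (∀ i j h, ContDiff ℝ (⊤ : ℕ∞) h → Periodic3 h → pd3 j (T i h) = T i (pd3 j h)) ∧
      (∀ i h M, (∀ x, |h x| ≤ M) → ∀ x, |T i h x| ≤ K * lam⁻¹ * M) ∧
      (∀ h, ContDiff ℝ (⊤ : ℕ∞) h → Periodic3 h → T 0 (pd3 1 h) = T 1 (pd3 0 h)) ∧
      (∀ h : (Fin 3 → ℝ) → ℝ, ContDiff ℝ (⊤ : ℕ∞) h → Periodic3 h →
        (∀ k, fc3 (fun x => (h x : ℂ)) k ≠ 0 → lam ≤ knorm k.1) →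
        T 0 (pd3 0 h) + T 1 (pd3 1 h) = h) := by
  obtain ⟨ψ, hψc, hψ, hψ1, hψone, hrot, hband⟩ := exists_radial_bandlimited_kernel
  refine ⟨∫ y, |‖y‖ * ψ y|, integral_nonneg fun y => abs_nonneg _, fun lam hlam => ?_⟩
  let L : Fin 2 → ℂ → ℝ := ![Complex.re, Complex.im]
  have hL : ∀ i, Continuous (L i) := Fin.forall_fin_two.2
    ⟨Complex.continuous_re, Complex.continuous_im⟩
  have hLn : ∀ i y, |L i y| ≤ ‖y‖ := Fin.forall_fin_two.2
    ⟨Complex.abs_re_le_norm, Complex.abs_im_le_norm⟩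
  have hw : ∀ i, Integrable (segWeight ψ lam (L i)) segMeasure := fun i =>
    integrable_segWeight hψc hψ1 (hL i) (hLn i) lam
  have hv := aestronglyMeasurable_segShift lam
  refine ⟨fun i => shiftAvg segMeasure (segWeight ψ lam (L i)) (segShift lam),
    fun i h hc hp => contDiff_shiftAvg (hw i) hv hc hp, fun i h hp => hp.shiftAvg,
    fun i j h hc hp => pd3_shiftAvg (hw i) hv hc hp j, fun i h M hM x => ?_,
    fun h hc hp => funext fun x => shiftAvg_segment_rotational hψc hψ1 hc hp hψ hrot hlam x,
    fun h hc hp hspec => funext fun x => ?_⟩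
  · refine (abs_shiftAvg_le (hw i) hM x).trans ?_
    rw [mul_comm _ lam⁻¹]
    exact mul_le_mul_of_nonneg_right (integral_abs_segWeight_le hψc hψ1 (hL i) (hLn i) hlam)
      ((abs_nonneg _).trans (hM 0))
  · refine (shiftAvg_segment_fderiv hψc hψ1 hc hp hψ hψone lam x).trans ?_
    rw [shiftAvg_eq_zero_of_spectrum hψ hband hc.continuous hp hlam hspec, sub_zero]

/-- **Inverse horizontal divergence of `X = (∂ₓ f, ∂_y f, g)`.**
There is a `3×3` matrix field `D` with vanishing third column, whose top-left `2×2` block is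
symmetric and traceless, such that the row-by-row horizontal divergence of `D` equals `X`,
with `‖D‖_{C⁰} ≤ C λ⁻¹ ‖X‖_{C⁰}`. -/
theorem inverse_divergence_of_X :
    ∃ C : ℝ, 0 < C ∧
      ∀ f g : (Fin 3 → ℝ) → ℝ, ContDiff ℝ (⊤ : ℕ∞) f → ContDiff ℝ (⊤ : ℕ∞) g →
        Periodic3 f → Periodic3 g →
        (∀ z : ℝ, (∫ y in box2, f ![y 0, y 1, z]) = 0) →
        (∀ z : ℝ, (∫ y in box2, g ![y 0, y 1, z]) = 0) →
        ∀ lam : ℝ, 0 < lam →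
        (∀ k : (ℤ × ℤ) × ℤ, k ≠ 0 → fc3 (fun x => (f x : ℂ)) k ≠ 0 → lam ≤ knorm k.1) →
        (∀ k : (ℤ × ℤ) × ℤ, k ≠ 0 → fc3 (fun x => (g x : ℂ)) k ≠ 0 → lam ≤ knorm k.1) →
        ∃ D : (Fin 3 → ℝ) → Fin 3 → Fin 3 → ℝ,
          ContDiff ℝ (⊤ : ℕ∞) D ∧ Periodic3 D ∧
          -- third column vanishes
          (∀ x (i : Fin 3), D x i 2 = 0) ∧
          -- top-left 2×2 block is symmetric and traceless
          (∀ x, D x 0 1 = D x 1 0) ∧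
          (∀ x, D x 0 0 + D x 1 1 = 0) ∧
          -- row-by-row horizontal divergence of D equals X = (∂ₓ f, ∂_y f, g)
          (∀ x (i : Fin 3),
            (∑ j : Fin 2, pd3 j.castSucc (fun y => D y i j.castSucc) x) =
              ![pd3 0 f x, pd3 1 f x, g x] i) ∧
          -- C⁰ bound
          (∀ x, ‖D x‖ ≤ C * lam⁻¹ * ⨆ y, ‖![pd3 0 f y, pd3 1 f y, g y]‖) := by

  obtain ⟨K, hK, hT⟩ := exists_inverse_gradient_operators
  refine ⟨2 * K + 1, by positivity, fun f g hf hg hpf hpg hf0 hg0 lam hlam hsf hsg => ?_⟩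
  obtain ⟨T, hTc, hTp, hTd, hTb, hTr, hTi⟩ := hT lam hlam
  have hif := hTi f hf hpf fun k hk => hsf k
    (fun h => hk (h ▸ fc3_zero_of_slice hf.continuous hf0)) hk
  have hig := hTi g hg hpg fun k hk => hsg k
    (fun h => hk (h ▸ fc3_zero_of_slice hg.continuous hg0)) hk
  have hcf := fun i => contDiff_pd3 hf i
  have hpf' := fun i => hpf.pd3 i
  have hcT : ∀ i j, ContDiff ℝ (⊤ : ℕ∞) (T i (pd3 j f)) := fun i j => hTc i _ (hcf j) (hpf' j)
  have hcg : ∀ i, ContDiff ℝ (⊤ : ℕ∞) (T i g) := fun i => hTc i _ hg hpg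
  have hdT : ∀ i j, Differentiable ℝ (T i (pd3 j f)) := fun i j =>
    (hcT i j).differentiable (by simp)
  have hcomm : pd3 0 (pd3 1 f) = pd3 1 (pd3 0 f) := funext fun x => pd3_comm hf 0 1 x
  have hd : ∀ i j k, pd3 k (T i (pd3 j f)) = T i (pd3 k (pd3 j f)) := fun i j k =>
    hTd i k _ (hcf j) (hpf' j)
  have hr : ∀ j, T 0 (pd3 1 (pd3 j f)) = T 1 (pd3 0 (pd3 j f)) := fun j =>
    hTr _ (hcf j) (hpf' j)
  let a : (Fin 3 → ℝ) → ℝ := fun x => T 0 (pd3 0 f) x - T 1 (pd3 1 f) x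
  let b : (Fin 3 → ℝ) → ℝ := fun x => T 0 (pd3 1 f) x + T 1 (pd3 0 f) x
  have hda : ∀ k x, pd3 k a x = T 0 (pd3 k (pd3 0 f)) x - T 1 (pd3 k (pd3 1 f)) x := fun k x => by
    rw [← hd, ← hd, pd3, fderiv_fun_sub (hdT 0 0 x) (hdT 1 1 x)]
    rfl
  have hdb : ∀ k x, pd3 k b x = T 0 (pd3 k (pd3 1 f)) x + T 1 (pd3 k (pd3 0 f)) x := fun k x => by
    rw [← hd, ← hd, pd3, fderiv_fun_add (hdT 0 1 x) (hdT 1 0 x)]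
    rfl
  have hdf : ∀ k x, pd3 k f x = T 0 (pd3 k (pd3 0 f)) x + T 1 (pd3 k (pd3 1 f)) x := fun k x => by
    rw [← hd, ← hd]
    conv_lhs => rw [← hif]
    rw [pd3, fderiv_add (hdT 0 0 x) (hdT 1 1 x)]
    rfl
  have hneg : ∀ k x, pd3 k (fun y => -a y) x = -pd3 k a x := fun k x => by
    rw [pd3, fderiv_fun_neg]
    rfl
  let X : (Fin 3 → ℝ) → Fin 3 → ℝ := fun y => ![pd3 0 f y, pd3 1 f y, g y]
  have hXp : Periodic3 X := fun x i => by simp only [X, hpf' 0 x i, hpf' 1 x i, hpg x i]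
  have hXc : Continuous X := by
    have h0 := (hcf 0).continuous
    have h1 := (hcf 1).continuous
    have h2 := hg.continuous
    refine continuous_pi fun i => ?_
    fin_cases i
    exacts [h0, h1, h2]
  have hbdd : BddAbove (Set.range fun y => ‖X y‖) := by
    obtain ⟨C, hC⟩ := hXp.exists_bound hXc
    exact ⟨C, by rintro _ ⟨y, rfl⟩; exact hC y⟩
  set M := ⨆ y, ‖X y‖ with hM
  have hXM : ∀ (i : Fin 3) y, |X y i| ≤ M := fun i y =>
    (norm_le_pi_norm (X y) i).trans (le_ciSup hbdd y)
  have hM0 : 0 ≤ M := (abs_nonneg _).trans (hXM 0 0)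
  have hbf0 : ∀ i x, |T i (pd3 0 f) x| ≤ K * lam⁻¹ * M := fun i => hTb i _ M (hXM 0)
  have hbf1 : ∀ i x, |T i (pd3 1 f) x| ≤ K * lam⁻¹ * M := fun i => hTb i _ M (hXM 1)
  have hbg : ∀ i x, |T i g x| ≤ K * lam⁻¹ * M := fun i => hTb i _ M (hXM 2)
  have hN : 0 ≤ K * lam⁻¹ * M := by positivity
  have hN1 : 0 ≤ lam⁻¹ * M := by positivity
  have hN2 : (2 * K + 1) * lam⁻¹ * M = 2 * (K * lam⁻¹ * M) + lam⁻¹ * M := by ring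
  have hba : ∀ x, |a x| ≤ (2 * K + 1) * lam⁻¹ * M := fun x => by
    have := abs_sub (T 0 (pd3 0 f) x) (T 1 (pd3 1 f) x)
    have := hbf0 0 x
    have := hbf1 1 x
    change |T 0 (pd3 0 f) x - T 1 (pd3 1 f) x| ≤ _
    linarith
  have hbb : ∀ x, |b x| ≤ (2 * K + 1) * lam⁻¹ * M := fun x => by
    have := abs_add_le (T 0 (pd3 1 f) x) (T 1 (pd3 0 f) x)
    have := hbf1 0 x
    have := hbf0 1 x
    change |T 0 (pd3 1 f) x + T 1 (pd3 0 f) x| ≤ _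
    linarith
  have hbg' : ∀ i x, |T i g x| ≤ (2 * K + 1) * lam⁻¹ * M := fun i x => by
    have := hbg i x
    linarith
  have hca : ContDiff ℝ (⊤ : ℕ∞) a := (hcT 0 0).sub (hcT 1 1)
  have hcb : ContDiff ℝ (⊤ : ℕ∞) b := (hcT 0 1).add (hcT 1 0)
  refine ⟨fun x => ![![a x, b x, 0], ![b x, -a x, 0], ![T 0 g x, T 1 g x, 0]],
    ?_, ?_, ?_, fun x => rfl, fun x => ?_, ?_, fun x => ?_⟩
  · refine contDiff_pi.2 fun i => contDiff_pi.2 fun j => ?_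
    fin_cases i <;> fin_cases j
    exacts [hca, hcb, contDiff_const, hcb, hca.neg, contDiff_const, hcg 0, hcg 1, contDiff_const]
  · intro x i
    have hp := fun m n => hTp m (pd3 n f) (hpf' n) x i
    simp only [a, b, hp, hTp _ g hpg x i]
  · intro x i
    fin_cases i <;> rfl
  · change a x + -a x = 0
    ring
  · intro x i
    rw [Fin.sum_univ_two]
    fin_cases i
    · change pd3 0 a x + pd3 1 b x = pd3 0 f x
      rw [hda, hdb, hdf, hr, hcomm]
      ring
    · change pd3 0 b x + pd3 1 (fun y => -a y) x = pd3 1 f x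
      rw [hneg, hda, hdb, hdf, ← hr, hcomm]
      ring
    · change pd3 0 (T 0 g) x + pd3 1 (T 1 g) x = g x
      rw [hTd 0 0 g hg hpg, hTd 1 1 g hg hpg]
      exact congrFun hig x
  · have hB : 0 ≤ (2 * K + 1) * lam⁻¹ * M := (abs_nonneg _).trans (hba x)
    refine (pi_norm_le_iff_of_nonneg hB).2 fun i => (pi_norm_le_iff_of_nonneg hB).2 fun j => ?_
    rw [Real.norm_eq_abs]
    fin_cases i <;> fin_cases j
    exacts [hba x, hbb x, by simpa using hB, hbb x, (abs_neg _).trans_le (hba x), by simpa using hB,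
      hbg' 0 x, hbg' 1 x, by simpa using hB]

end
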